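/- For any finite open covers 𝒰^{(i)} of X_i (i=1,…,r) and any μ ∈ M^G(X_1): Σ_{i=1}^r w_i h^−_{μ_i}(𝒰^{(i)},G) + w_1 ∫_{X_1} f dμ ≤ P^a(G,f,𝒰^{(1)},…,𝒰^{(r)}). -/

import Mathlib

open scoped BigOperators NNReal
open Filter

namespace WPP

variable (G : Type) [Group G]

/-- `B(F,K) = {g ∈ G : Kg ∩ F ≠ ∅ and Kg ∩ (G∖F) ≠ ∅}`. -/
def folnerB (F K : Finset G) : Set G :=
  {g : G | (∃ k ∈ K, k * g ∈ F) ∧ ∃ k ∈ K, k * g ∉ F}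

/-- A Følner sequence of `G`. -/
def IsFolner (F : ℕ → Finset G) : Prop :=
  (∀ n, (F n).Nonempty) ∧
    ∀ K : Finset G, K.Nonempty →
      Tendsto (fun n => ((folnerB G (F n) K).ncard : ℝ) / ((F n).card : ℝ)) atTop (nhds 0)

/-- A `G`-system: a compact metric space together with a continuous action of `G`
by homeomorphisms. -/
structure GSystem where
  carrier : Type
  [metric : MetricSpace carrier]
  [cpt : CompactSpace carrier]
  act : G → carrier → carrier
  one_act : ∀ x, act 1 x = x
  mul_act : ∀ g h x, act (g * h) x = act g (act h x)
  cont_act : ∀ g, Continuous (act g)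

attribute [instance] GSystem.metric GSystem.cpt

variable {G}

noncomputable instance (S : GSystem G) : MeasurableSpace S.carrier := borel S.carrier
instance (S : GSystem G) : BorelSpace S.carrier := ⟨rfl⟩

/-- A factor map between `G`-systems: a continuous equivariant surjection. -/
structure FactorMap (S T : GSystem G) where
  toFun : S.carrier → T.carrier
  cont : Continuous toFun
  surj : Function.Surjective toFun
  equiv : ∀ g x, toFun (S.act g x) = T.act g (toFun x)

/-- The dynamical (Bowen) metric `d_F(x,y) = max_{g∈F} d(gx,gy)`. -/
noncomputable def dynDist (S : GSystem G) (F : Finset G) (x y : S.carrier) : ℝ :=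
  ((F.sup fun g => nndist (S.act g x) (S.act g y) : ℝ≥0) : ℝ)

/-- `diam(U, d_F) < ε`. -/
def diamLT (S : GSystem G) (F : Finset G) (U : Set S.carrier) (ε : ℝ) : Prop :=
  ∀ x ∈ U, ∀ y ∈ U, dynDist S F x y < ε

/-- The Birkhoff-type sum `S_F f(x) = Σ_{g∈F} f(gx)`. -/
noncomputable def birk (S : GSystem G) (f : S.carrier → ℝ) (F : Finset G) (x : S.carrier) : ℝ :=
  ∑ g ∈ F, f (S.act g x)

variable (X : ℕ → GSystem G) (π : ∀ i, FactorMap (X i) (X (i + 1)))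

/-- The recursively defined weighted quantities `P^a_{i+1}(Ω, f, F, ε)` (0-indexed: `wP … i`
corresponds to the paper's `P^a_{i+1}`, and `a i` to the paper's `a_{i+1}`). -/
noncomputable def wP (a : ℕ → ℝ) (f : (X 0).carrier → ℝ) (F : Finset G) (ε : ℝ) :
    (i : ℕ) → Set (X i).carrier → ℝ
  | 0, Ω => sInf {s | ∃ (n : ℕ) (U : Fin n → Set (X 0).carrier),
      (∀ j, IsOpen (U j)) ∧ (Ω ⊆ ⋃ j, U j) ∧ (∀ j, diamLT (X 0) F (U j) ε) ∧
      s = ∑ j, Real.exp (sSup (birk (X 0) f F '' U j))}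
  | i + 1, Ω => sInf {s | ∃ (n : ℕ) (U : Fin n → Set (X (i + 1)).carrier),
      (∀ j, IsOpen (U j)) ∧ (Ω ⊆ ⋃ j, U j) ∧ (∀ j, diamLT (X (i + 1)) F (U j) ε) ∧
      s = ∑ j, (wP a f F ε i ((π i).toFun ⁻¹' U j)) ^ (a i)}

/-- `lim_n log P^a_r(X_r, f, F_n, ε) / |F_n|` (realized as a `limsup` in `EReal`; by the
Ornstein–Weiss lemma the limit exists, so this is the limit). -/
noncomputable def pressEps (r : ℕ) (a : ℕ → ℝ) (f : (X 0).carrier → ℝ)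
    (Fn : ℕ → Finset G) (ε : ℝ) : EReal :=
  limsup (fun n =>
    ((Real.log (wP X π a f (Fn n) ε (r - 1) Set.univ) / ((Fn n).card : ℝ) : ℝ) : EReal)) atTop

/-- The `a`-weighted topological pressure `P^a(f,G) = lim_{ε→0} P^a(X_r,f,ε)`; since
`P^a(X_r,f,ε)` is non-decreasing as `ε` decreases, the limit equals the supremum over `ε > 0`. -/
noncomputable def press (r : ℕ) (a : ℕ → ℝ) (f : (X 0).carrier → ℝ)
    (Fn : ℕ → Finset G) : EReal :=
  ⨆ (ε : ℝ) (_ : 0 < ε), pressEps X π r a f Fn ε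

/-- Entropy `H_μ(p)` of a countable partition given by the fibers of `p`. -/
noncomputable def Hpart {Y : Type} [MeasurableSpace Y] {ι : Type}
    (μ : MeasureTheory.Measure Y) (p : Y → ι) : ℝ :=
  ∑' i : ι, Real.negMulLog ((μ (p ⁻¹' {i})).toReal)

/-- `h_μ(p, G) = lim_n H_μ(p_{F_n})/|F_n|` (realized as a `limsup`, which equals the limit
since the limit exists). -/
noncomputable def hSeq (S : GSystem G) (Fn : ℕ → Finset G)
    (μ : MeasureTheory.Measure S.carrier) (p : S.carrier → ℕ) : ℝ :=
  limsup (fun n =>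
    Hpart μ (fun x => fun g : (Fn n : Finset G) => p (S.act (g : G) x)) / ((Fn n).card : ℝ)) atTop

/-- The measure-theoretic entropy `h_μ(X,G)`: supremum of `h_μ(α,G)` over all finite
measurable partitions (encoded as measurable maps to `ℕ` with finite range). -/
noncomputable def mEnt (S : GSystem G) (Fn : ℕ → Finset G)
    (μ : MeasureTheory.Measure S.carrier) : EReal :=
  ⨆ p : {p : S.carrier → ℕ // Measurable p ∧ (Set.range p).Finite},
    ((hSeq S Fn μ p.1 : ℝ) : EReal)

/-- `μ ∈ M^G(X)`: a `G`-invariant Borel probability measure. -/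
def IsInvProb (S : GSystem G) (μ : MeasureTheory.Measure S.carrier) : Prop :=
  MeasureTheory.IsProbabilityMeasure μ ∧ ∀ g : G, μ.map (S.act g) = μ

/-- `π^{(i)} = π_i ∘ ⋯ ∘ π_1 : X_1 → X_{i+1}` (0-indexed). -/
noncomputable def chainMap : (i : ℕ) → (X 0).carrier → (X i).carrier
  | 0 => id
  | i + 1 => (π i).toFun ∘ chainMap i

/-- The weights `w_1 = a_1⋯a_{r−1}`, `w_i = (1−a_{i−1})a_i⋯a_{r−1}`, `w_r = 1−a_{r−1}`
(0-indexed: `wt a r i` is the paper's `w_{i+1}`, `a j` the paper's `a_{j+1}`). -/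
noncomputable def wt (a : ℕ → ℝ) (r i : ℕ) : ℝ :=
  if i = 0 then ∏ j ∈ Finset.range (r - 1), a j
  else (1 - a (i - 1)) * ∏ j ∈ Finset.Ico i (r - 1), a j

/-- `Σ_{i=1}^r w_i h_{μ_i}(X_i,G) + w_1 ∫ f dμ`. -/
noncomputable def wSum (r : ℕ) (a : ℕ → ℝ) (Fn : ℕ → Finset G) (f : (X 0).carrier → ℝ)
    (μ : MeasureTheory.Measure (X 0).carrier) : EReal :=
  (∑ i ∈ Finset.range r, ((wt a r i : ℝ) : EReal) * mEnt (X i) Fn (μ.map (chainMap X π i)))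
    + (((wt a r 0) * ∫ x, f x ∂μ : ℝ) : EReal)

/-- `P^a_var(f,G) = sup_{μ ∈ M^G(X_1)} ( Σ w_i h_{μ_i}(X_i,G) + w_1 ∫ f dμ )`. -/
noncomputable def Pvar (r : ℕ) (a : ℕ → ℝ) (Fn : ℕ → Finset G)
    (f : (X 0).carrier → ℝ) : EReal :=
  ⨆ μ : {μ : MeasureTheory.Measure (X 0).carrier // IsInvProb (X 0) μ},
    wSum X π r a Fn f μ.1

end WPP

namespace WPP

open Filter

variable {G : Type} [Group G]

/-- A finite open cover of the whole space. -/
def IsFinOpenCover (S : GSystem G) (U : Finset (Set S.carrier)) : Prop :=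
  (∀ A ∈ U, IsOpen A) ∧ ⋃₀ (U : Set (Set S.carrier)) = Set.univ

/-- `𝒱 ⪰ 𝒰`: the family `𝒱` refines `𝒰` (every member of `𝒱` is contained in some
member of `𝒰`). -/
def Refines {Y : Type} (V U : Finset (Set Y)) : Prop :=
  ∀ A ∈ V, ∃ B ∈ U, A ⊆ B

open Classical in
/-- The dynamical refinement `𝒰_F = ⋁_{g∈F} g⁻¹𝒰`. -/
noncomputable def coverJoin (S : GSystem G) (U : Finset (Set S.carrier)) (F : Finset G)
    [DecidableEq G] : Finset (Set S.carrier) :=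
  (F.pi fun _ => U).image fun c => ⋂ g, ⋂ (h : g ∈ F), S.act g ⁻¹' (c g h)

/-- A finite measurable partition of the whole space (as a finite family of sets). -/
def IsMPartition {Y : Type} [MeasurableSpace Y] (α : Finset (Set Y)) : Prop :=
  (∀ A ∈ α, MeasurableSet A) ∧ (⋃₀ (α : Set (Set Y)) = Set.univ) ∧
    ∀ A ∈ α, ∀ B ∈ α, A ≠ B → A ∩ B = ∅

/-- `H_μ(α) = −Σ_{A∈α} μ(A) log μ(A)`. -/
noncomputable def Hfin {Y : Type} [MeasurableSpace Y] (μ : MeasureTheory.Measure Y)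
    (α : Finset (Set Y)) : ℝ :=
  ∑ A ∈ α, Real.negMulLog ((μ A).toReal)

/-- `H_μ(𝒰) = inf{H_μ(α) : α a finite measurable partition refining 𝒰}`. -/
noncomputable def covEnt {Y : Type} [MeasurableSpace Y] (μ : MeasureTheory.Measure Y)
    (U : Finset (Set Y)) : ℝ :=
  sInf {h | ∃ α : Finset (Set Y), IsMPartition α ∧ Refines α U ∧ h = Hfin μ α}

/-- `h⁻_μ(𝒰,G) = lim_n H_μ(𝒰_{F_n})/|F_n|` (realized as a `limsup`, equal to the limit
since the limit exists). -/
noncomputable def hMinus (S : GSystem G) [DecidableEq G] (Fn : ℕ → Finset G)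
    (μ : MeasureTheory.Measure S.carrier) (U : Finset (Set S.carrier)) : ℝ :=
  limsup (fun n => covEnt μ (coverJoin S U (Fn n)) / ((Fn n).card : ℝ)) atTop

variable (X : ℕ → GSystem G) (π : ∀ i, FactorMap (X i) (X (i + 1))) [DecidableEq G]

/-- The cover-relative weighted quantities `P^a_{i+1}(Ω, f, F, 𝒰^{(i+1)})` of Section 3
(0-indexed). -/
noncomputable def wPU (a : ℕ → ℝ) (f : (X 0).carrier → ℝ) (F : Finset G)
    (Us : ∀ i, Finset (Set (X i).carrier)) :
    (i : ℕ) → Set (X i).carrier → ℝ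
  | 0, Ω => sInf {s | ∃ V W : Finset (Set (X 0).carrier),
      (⋃₀ (W : Set (Set (X 0).carrier)) = Set.univ) ∧
      Refines W (coverJoin (X 0) (Us 0) F) ∧ V ⊆ W ∧ (Ω ⊆ ⋃₀ (V : Set (Set (X 0).carrier))) ∧
      s = ∑ A ∈ V, Real.exp (sSup (birk (X 0) f F '' A))}
  | i + 1, Ω => sInf {s | ∃ V W : Finset (Set (X (i + 1)).carrier),
      (⋃₀ (W : Set (Set (X (i + 1)).carrier)) = Set.univ) ∧
      Refines W (coverJoin (X (i + 1)) (Us (i + 1)) F) ∧ V ⊆ W ∧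
      (Ω ⊆ ⋃₀ (V : Set (Set (X (i + 1)).carrier))) ∧
      s = ∑ A ∈ V, (wPU a f F Us i ((π i).toFun ⁻¹' A)) ^ (a i)}

/-- `P^a(G,f,𝒰^{(1)},…,𝒰^{(r)}) = lim_n log P^a_r(X_r,f,F_n,𝒰^{(r)})/|F_n|`
(realized as a `limsup` in `EReal`, equal to the limit since the limit exists). -/
noncomputable def pressU (r : ℕ) (a : ℕ → ℝ) (f : (X 0).carrier → ℝ)
    (Fn : ℕ → Finset G) (Us : ∀ i, Finset (Set (X i).carrier)) : EReal :=
  limsup (fun n =>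
    ((Real.log (wPU X π a f (Fn n) Us (r - 1) Set.univ) / ((Fn n).card : ℝ) : ℝ) : EReal)) atTop

end WPP

namespace WPP

open Pointwise

section OrnsteinWeiss

variable {G : Type} [Group G]

theorem finite_folnerB (D K : Finset G) : (folnerB G D K).Finite := by
  classical
  refine (K⁻¹ * D).finite_toSet.subset ?_
  rintro g ⟨⟨k, hk, hg⟩, -⟩
  exact Finset.mem_coe.2 (Finset.mem_mul.2 ⟨k⁻¹, Finset.inv_mem_inv hk, k * g, hg, by group⟩)

theorem ncard_folnerB_mono (D : Finset G) {K K' : Finset G} (h : K ⊆ K') :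
    (folnerB G D K).ncard ≤ (folnerB G D K').ncard := by
  refine Set.ncard_le_ncard ?_ (finite_folnerB D K')
  rintro g ⟨⟨k, hk, hg⟩, k', hk', hg'⟩
  exact ⟨⟨k, h hk, hg⟩, k', h hk', hg'⟩

variable [DecidableEq G]

theorem ncard_folnerB_sdiff_mul_le (D A R K : Finset G) :
    (folnerB G (D \ (A * R)) K).ncard ≤
      (folnerB G D K).ncard + R.card * (folnerB G A K).ncard := by
  have hsub : folnerB G (D \ (A * R)) K ⊆
      folnerB G D K ∪ ⋃ g ∈ R, (fun x => x * g) '' folnerB G A K := by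
    rintro x ⟨⟨k, hk, hkx⟩, k', hk', hkx'⟩
    rw [Finset.mem_sdiff] at hkx hkx'
    by_cases h : k' * x ∈ D
    · have h2 : k' * x ∈ A * R := by
        by_contra h3
        exact hkx' ⟨h, h3⟩
      obtain ⟨u, hu, g, hg, hug⟩ := Finset.mem_mul.1 h2
      refine Or.inr (Set.mem_biUnion hg ⟨x * g⁻¹, ⟨⟨k', hk', ?_⟩, k, hk, ?_⟩, by simp⟩)
      · rw [← mul_assoc, ← hug]
        simpa using hu
      · intro h4
        exact hkx.2 (Finset.mem_mul.2 ⟨_, h4, g, hg, by group⟩)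
    · exact Or.inl ⟨⟨k, hk, hkx.1⟩, k', hk', h⟩
  have hfin : ∀ g ∈ R, ((fun x => x * g) '' folnerB G A K).Finite := fun g _ =>
    (finite_folnerB A K).image _
  refine (Set.ncard_le_ncard hsub ((finite_folnerB D K).union
    (R.finite_toSet.biUnion hfin))).trans ((Set.ncard_union_le _ _).trans ?_)
  gcongr
  refine (Finset.set_ncard_biUnion_le R _).trans ?_
  rw [← smul_eq_mul]
  exact Finset.sum_le_card_nsmul _ _ _ fun g _ => Set.ncard_image_le (finite_folnerB A K)

/-- A maximal family of almost disjoint right translates of `A` inside `D` fills a definite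
proportion of `D`. -/
theorem exists_almost_disjoint_translates (A D : Finset G) (hA : A.Nonempty) {ε : ℝ}
    (hε : 0 < ε) (hε1 : ε < 1) :
    ∃ R : Finset G, A * R ⊆ D ∧ (1 - ε) * (A.card * R.card) ≤ ((A * R).card : ℝ) ∧
      ε * (D.card - (folnerB G D (insert 1 A)).ncard) ≤ ((A * R).card : ℝ) := by
  classical
  set I := D.filter fun g => ∀ k ∈ A, k * g ∈ D with hI
  set S := I.powerset.filter fun R =>
    (1 - ε) * (A.card * R.card) ≤ ((A * R).card : ℝ) with hS
  obtain ⟨R, hR, hmax⟩ := Finset.exists_max_image S Finset.card ⟨∅, by simp [hS]⟩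
  have hRI : R ⊆ I := Finset.mem_powerset.1 (Finset.mem_filter.1 hR).1
  have hRc := (Finset.mem_filter.1 hR).2
  have hApos : (0 : ℝ) < A.card := by exact_mod_cast hA.card_pos
  refine ⟨R, ?_, hRc, ?_⟩
  · intro x hx
    obtain ⟨k, hk, g, hg, rfl⟩ := Finset.mem_mul.1 hx
    exact (Finset.mem_filter.1 (hRI hg)).2 k hk
  have key : ∀ g ∈ I, ε * A.card ≤ ((A.filter fun k => k * g ∈ A * R).card : ℝ) := by
    intro g hg
    by_cases hgR : g ∈ R
    · rw [Finset.filter_true_of_mem fun k hk => Finset.mul_mem_mul hk hgR]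
      nlinarith
    by_contra! hlt
    have hcard : ((A * R).card : ℝ) + (A.card - (A.filter fun k => k * g ∈ A * R).card) ≤
        ((A * insert g R).card : ℝ) := by
      have hsub : A * R ∪ (A.filter fun k => k * g ∉ A * R).image (· * g) ⊆ A * insert g R := by
        refine Finset.union_subset (Finset.mul_subset_mul_left (Finset.subset_insert g R)) ?_
        intro x hx
        obtain ⟨k, hk, rfl⟩ := Finset.mem_image.1 hx
        exact Finset.mul_mem_mul (Finset.mem_filter.1 hk).1 (Finset.mem_insert_self g R)
      have hdisj : Disjoint (A * R) ((A.filter fun k => k * g ∉ A * R).image (· * g)) := by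
        rw [Finset.disjoint_right]
        intro x hx
        obtain ⟨k, hk, rfl⟩ := Finset.mem_image.1 hx
        exact (Finset.mem_filter.1 hk).2
      have h1 := Finset.card_le_card hsub
      rw [Finset.card_union_of_disjoint hdisj,
        Finset.card_image_of_injective _ (mul_left_injective g)] at h1
      have h2 := Finset.card_filter_add_card_filter_not (s := A) (fun k => k * g ∈ A * R)
      have h1' : ((A * R).card : ℝ) + ((A.filter fun k => k * g ∉ A * R).card : ℝ) ≤
        (A * insert g R).card := by exact_mod_cast h1
      have h2' : ((A.filter fun k => k * g ∈ A * R).card : ℝ) +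
        (A.filter fun k => k * g ∉ A * R).card = A.card := by exact_mod_cast h2
      linarith
    have hmem : insert g R ∈ S := by
      refine Finset.mem_filter.2 ⟨Finset.mem_powerset.2 (Finset.insert_subset hg hRI), ?_⟩
      rw [Finset.card_insert_of_notMem hgR]
      push_cast
      nlinarith
    have := hmax _ hmem
    rw [Finset.card_insert_of_notMem hgR] at this
    omega
  have hcount : ∑ g ∈ I, (A.filter fun k => k * g ∈ A * R).card ≤ A.card * (A * R).card := by
    have := Finset.sum_card_bipartiteAbove_eq_sum_card_bipartiteBelow
      (s := I) (t := A) (fun g k => k * g ∈ A * R)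
    simp only [Finset.bipartiteAbove, Finset.bipartiteBelow] at this
    rw [this, ← smul_eq_mul]
    refine Finset.sum_le_card_nsmul _ _ _ fun k _ => ?_
    rw [← Finset.card_image_of_injective _ (mul_right_injective k)]
    refine Finset.card_le_card fun x hx => ?_
    obtain ⟨g, hg, rfl⟩ := Finset.mem_image.1 hx
    exact (Finset.mem_filter.1 hg).2
  have hIcard : (D.card : ℝ) - (folnerB G D (insert 1 A)).ncard ≤ I.card := by
    have h1 : (D.filter fun g => ¬ ∀ k ∈ A, k * g ∈ D).card ≤
        (folnerB G D (insert 1 A)).ncard := by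
      rw [← Set.ncard_coe_finset]
      refine Set.ncard_le_ncard ?_ (finite_folnerB _ _)
      intro g hg
      obtain ⟨hgD, hg2⟩ := Finset.mem_filter.1 (Finset.mem_coe.1 hg)
      push Not at hg2
      obtain ⟨k, hk, hkg⟩ := hg2
      exact ⟨⟨1, Finset.mem_insert_self _ _, by simpa using hgD⟩, k,
        Finset.mem_insert_of_mem hk, hkg⟩
    have h2 := Finset.card_filter_add_card_filter_not (s := D) (fun g => ∀ k ∈ A, k * g ∈ D)
    rw [← hI] at h2
    have h3 : D.card ≤ I.card + (folnerB G D (insert 1 A)).ncard := by omega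
    have h3' : (D.card : ℝ) ≤ I.card + (folnerB G D (insert 1 A)).ncard := by exact_mod_cast h3
    linarith
  have hsum : (I.card : ℝ) * (ε * A.card) ≤ A.card * (A * R).card := by
    calc (I.card : ℝ) * (ε * A.card) = ∑ g ∈ I, ε * A.card := by simp
      _ ≤ ∑ g ∈ I, ((A.filter fun k => k * g ∈ A * R).card : ℝ) := Finset.sum_le_sum key
      _ ≤ _ := by exact_mod_cast hcount
  have h4 : ε * I.card ≤ (A * R).card := by
    refine le_of_mul_le_mul_left ?_ hApos
    linarith
  nlinarith

theorem subadditive_mul_le {h : Finset G → ℝ} (h0 : h ∅ ≤ 0)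
    (hsub : ∀ A B, h (A ∪ B) ≤ h A + h B) (hinv : ∀ A g, h (A * {g}) ≤ h A)
    (A R : Finset G) : h (A * R) ≤ R.card * h A := by
  induction R using Finset.induction_on with
  | empty => simpa using h0
  | insert g R hg ih =>
    rw [Finset.card_insert_of_notMem hg, Finset.insert_eq, Finset.mul_union]
    push_cast
    linarith [hsub (A * {g}) (A * R), hinv A g]

/-- Quasi-tiling estimate: a set sufficiently invariant relative to `N` is filled by almost
disjoint translates of sets on which `h` is at most `c` times the cardinality. -/
theorem exists_quasitiling_bound {Fn : ℕ → Finset G} (hFn : IsFolner G Fn) {h : Finset G → ℝ}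
    (h0 : h ∅ ≤ 0) (hsub : ∀ A B, h (A ∪ B) ≤ h A + h B) (hinv : ∀ A g, h (A * {g}) ≤ h A)
    {c C : ℝ} (hc : 0 ≤ c) (hC0 : 0 ≤ C) (hC : ∀ A : Finset G, h A ≤ C * A.card)
    (hfreq : ∃ᶠ n in atTop, h (Fn n) ≤ c * (Fn n).card)
    {ε : ℝ} (hε : 0 < ε) (hε1 : ε < 1) (k : ℕ) :
    ∀ γ : ℝ, 0 < γ → ∃ (K : Finset G) (δ : ℝ), K.Nonempty ∧ 0 < δ ∧
      ∀ (D : Finset G) (N : ℝ), (D.card : ℝ) ≤ N → ((folnerB G D K).ncard : ℝ) ≤ δ * N →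
        h D ≤ c / (1 - ε) * D.card + C * ((1 - ε) ^ k * D.card + γ * N) := by
  have h1ε : 0 < 1 - ε := by linarith
  have hcε : 0 ≤ c / (1 - ε) := div_nonneg hc h1ε.le
  induction k with
  | zero =>
    refine fun γ hγ => ⟨{1}, 1, by simp, one_pos, fun D N hDN _ => ?_⟩
    have hN : 0 ≤ N := (Nat.cast_nonneg _).trans hDN
    have h1 : 0 ≤ c / (1 - ε) * D.card := by positivity
    have h2 : 0 ≤ C * (γ * N) := by positivity
    have := hC D
    rw [pow_zero]
    linarith
  | succ k ih =>
    intro γ hγ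
    obtain ⟨K, δ, hK, hδ, hD⟩ := ih (γ / 2) (by positivity)
    have hδ' : 0 < δ / 2 * (1 - ε) := by positivity
    obtain ⟨n, hn, hnK⟩ := (hfreq.and_eventually ((hFn.2 K hK).eventually_lt_const hδ')).exists
    set A := Fn n
    have hA : A.Nonempty := hFn.1 n
    have hApos : (0 : ℝ) < A.card := by exact_mod_cast hA.card_pos
    refine ⟨K ∪ insert 1 A, min (δ / 2) (γ / 2), ?_, by positivity, fun D N hDN hDK => ?_⟩
    · exact hK.mono Finset.subset_union_left
    have hN : 0 ≤ N := (Nat.cast_nonneg _).trans hDN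
    obtain ⟨R, hRD, hR1, hR2⟩ := exists_almost_disjoint_translates A D hA hε hε1
    have hm1 : ((folnerB G D K).ncard : ℝ) ≤ (folnerB G D (K ∪ insert 1 A)).ncard := by
      exact_mod_cast ncard_folnerB_mono D Finset.subset_union_left
    have hm2 : ((folnerB G D (insert 1 A)).ncard : ℝ) ≤ (folnerB G D (K ∪ insert 1 A)).ncard := by
      exact_mod_cast ncard_folnerB_mono D Finset.subset_union_right
    have hd1 : min (δ / 2) (γ / 2) * N ≤ δ / 2 * N := by gcongr; exact min_le_left _ _
    have hd2 : min (δ / 2) (γ / 2) * N ≤ γ / 2 * N := by gcongr; exact min_le_right _ _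
    have hcard : ((D \ (A * R)).card : ℝ) + (A * R).card = D.card := by
      exact_mod_cast Finset.card_sdiff_add_card_eq_card hRD
    have hARD : ((A * R).card : ℝ) ≤ D.card := by exact_mod_cast Finset.card_le_card hRD
    have hAR0 : (0 : ℝ) ≤ (A * R).card := Nat.cast_nonneg _
    have hnK' : ((folnerB G A K).ncard : ℝ) ≤ δ / 2 * (1 - ε) * A.card :=
      ((div_lt_iff₀ hApos).1 hnK).le
    have hbd : ((folnerB G (D \ (A * R)) K).ncard : ℝ) ≤ δ * N := by
      have h1 : ((folnerB G (D \ (A * R)) K).ncard : ℝ) ≤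
          (folnerB G D K).ncard + R.card * (folnerB G A K).ncard := by
        exact_mod_cast ncard_folnerB_sdiff_mul_le D A R K
      have h2 : (R.card : ℝ) * (folnerB G A K).ncard ≤ R.card * (δ / 2 * (1 - ε) * A.card) := by
        gcongr
      have h3 : (R.card : ℝ) * (δ / 2 * (1 - ε) * A.card) ≤ δ / 2 * N := by
        calc (R.card : ℝ) * (δ / 2 * (1 - ε) * A.card)
            = δ / 2 * ((1 - ε) * (A.card * R.card)) := by ring
          _ ≤ δ / 2 * N := by gcongr; linarith
      linarith
    have hmain := hD (D \ (A * R)) N (by linarith) hbd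
    have hhD : h D ≤ h (A * R) + h (D \ (A * R)) := by
      have := hsub (A * R) (D \ (A * R))
      rwa [Finset.union_sdiff_of_subset hRD] at this
    have hhAR : h (A * R) ≤ c / (1 - ε) * (A * R).card := by
      calc h (A * R) ≤ R.card * h A := subadditive_mul_le h0 hsub hinv A R
        _ ≤ R.card * (c * A.card) := by gcongr
        _ = c / (1 - ε) * ((1 - ε) * (A.card * R.card)) := by field_simp
        _ ≤ _ := by gcongr
    have hp1 : (1 - ε) ^ k ≤ 1 := pow_le_one₀ h1ε.le (by linarith)
    have hp0 : 0 ≤ (1 - ε) ^ k := by positivity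
    have hle : ((D \ (A * R)).card : ℝ) ≤ (1 - ε) * D.card + γ / 2 * N := by
      have : ε * ((folnerB G D (insert 1 A)).ncard : ℝ) ≤ γ / 2 * N := by
        have : ((folnerB G D (insert 1 A)).ncard : ℝ) ≤ γ / 2 * N := by linarith
        nlinarith [Nat.cast_nonneg (α := ℝ) (folnerB G D (insert 1 A)).ncard]
      nlinarith
    have hrem : (1 - ε) ^ k * ((D \ (A * R)).card : ℝ) + γ / 2 * N ≤
        (1 - ε) ^ (k + 1) * D.card + γ * N := by
      have h1 : (1 - ε) ^ k * ((D \ (A * R)).card : ℝ) ≤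
        (1 - ε) ^ k * ((1 - ε) * D.card + γ / 2 * N) := by gcongr
      have h2 : (1 - ε) ^ k * (γ / 2 * N) ≤ γ / 2 * N :=
        mul_le_of_le_one_left (by positivity) hp1
      rw [pow_succ]
      linarith
    have := mul_le_mul_of_nonneg_left hrem hC0
    have : c / (1 - ε) * (D \ (A * R)).card + c / (1 - ε) * (A * R).card =
      c / (1 - ε) * D.card := by rw [← hcard]; ring
    linarith

/-- The Ornstein–Weiss lemma. -/
theorem tendsto_limsup_of_subadditive {Fn : ℕ → Finset G} (hFn : IsFolner G Fn)
    {h : Finset G → ℝ} (hnn : ∀ A, 0 ≤ h A) (h0 : h ∅ ≤ 0)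
    (hsub : ∀ A B, h (A ∪ B) ≤ h A + h B) (hinv : ∀ A g, h (A * {g}) ≤ h A) :
    Tendsto (fun n => h (Fn n) / (Fn n).card) atTop
      (nhds (limsup (fun n => h (Fn n) / (Fn n).card) atTop)) := by
  set u : ℕ → ℝ := fun n => h (Fn n) / (Fn n).card with hu
  set C := h {1} with hCdef
  have hC0 : 0 ≤ C := hnn _
  have hC : ∀ A : Finset G, h A ≤ C * A.card := fun A => by
    have := subadditive_mul_le h0 hsub hinv {1} A
    rw [Finset.singleton_one, one_mul, ← Finset.singleton_one] at this
    linarith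
  have hpos : ∀ n, (0 : ℝ) < (Fn n).card := fun n => by exact_mod_cast (hFn.1 n).card_pos
  have hu0 : ∀ n, 0 ≤ u n := fun n => div_nonneg (hnn _) (hpos n).le
  have hu1 : ∀ n, u n ≤ C := fun n => (div_le_iff₀ (hpos n)).2 (hC _)
  have hb : IsBoundedUnder (· ≤ ·) atTop u := isBoundedUnder_of ⟨C, hu1⟩
  have hb' : IsBoundedUnder (· ≥ ·) atTop u := isBoundedUnder_of ⟨0, hu0⟩
  refine tendsto_of_le_liminf_of_limsup_le ?_ le_rfl hb hb'
  refine le_of_forall_gt_imp_ge_of_dense fun t ht => ?_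
  have hl0 : 0 ≤ liminf u atTop :=
    le_liminf_of_le hb.isCoboundedUnder_ge (Eventually.of_forall hu0)
  obtain ⟨c, hlc, hct⟩ := exists_between ht
  have hc : 0 ≤ c := hl0.trans hlc.le
  have hfreq : ∃ᶠ n in atTop, h (Fn n) ≤ c * (Fn n).card :=
    (frequently_lt_of_liminf_lt hb.isCoboundedUnder_ge hlc).mono fun n hn =>
      ((div_lt_iff₀ (hpos n)).1 hn).le
  obtain ⟨ε, hε, hε1, hεt⟩ : ∃ ε : ℝ, 0 < ε ∧ ε < 1 ∧ c / (1 - ε) < t := by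
    have hcont : Tendsto (fun ε : ℝ => c / (1 - ε)) (nhdsWithin 0 (Set.Ioi 0)) (nhds c) := by
      have : ContinuousAt (fun ε : ℝ => c / (1 - ε)) 0 :=
        continuousAt_const.div (continuousAt_const.sub continuousAt_id) (by simp)
      simpa using this.tendsto.mono_left nhdsWithin_le_nhds
    obtain ⟨ε, h1, h2⟩ := ((hcont.eventually_lt_const hct).and
      (Ioo_mem_nhdsGT (zero_lt_one' ℝ))).exists
    exact ⟨ε, h2.1, h2.2, h1⟩
  have hgap : 0 < t - c / (1 - ε) := by linarith
  obtain ⟨k, hk⟩ : ∃ k : ℕ, C * (1 - ε) ^ k < (t - c / (1 - ε)) / 2 := by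
    have : Tendsto (fun k : ℕ => C * (1 - ε) ^ k) atTop (nhds (C * 0)) :=
      (tendsto_pow_atTop_nhds_zero_of_lt_one (by linarith) (by linarith)).const_mul C
    rw [mul_zero] at this
    exact (this.eventually_lt_const (by linarith)).exists
  obtain ⟨K, δ, hK, hδ, hbound⟩ := exists_quasitiling_bound hFn h0 hsub hinv hc hC0 hC hfreq
    hε hε1 k ((t - c / (1 - ε)) / (2 * (C + 1))) (by positivity)
  have hγ : C * ((t - c / (1 - ε)) / (2 * (C + 1))) ≤ (t - c / (1 - ε)) / 2 := by
    rw [← mul_div_assoc, div_le_div_iff₀ (by positivity) (by positivity)]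
    nlinarith
  refine limsup_le_of_le hb'.isCoboundedUnder_le ?_
  filter_upwards [(hFn.2 K hK).eventually_lt_const hδ] with n hn
  refine (div_le_iff₀ (hpos n)).2 ?_
  refine (hbound (Fn n) _ le_rfl ((div_lt_iff₀ (hpos n)).1 hn).le).trans ?_
  have : c / (1 - ε) * ((Fn n).card : ℝ) + C * ((1 - ε) ^ k * (Fn n).card +
      (t - c / (1 - ε)) / (2 * (C + 1)) * (Fn n).card) =
      (c / (1 - ε) + C * (1 - ε) ^ k + C * ((t - c / (1 - ε)) / (2 * (C + 1)))) *
        (Fn n).card := by ring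
  rw [this]
  gcongr
  linarith

end OrnsteinWeiss

end WPP

namespace WPP

open MeasureTheory

section Gibbs

theorem sum_negMulLog_add_mul_log_le {ι : Type} (s : Finset ι) (m t : ι → ℝ) {c : ℝ}
    (hm : ∀ j ∈ s, 0 ≤ m j) (ht : ∀ j ∈ s, 0 ≤ t j) (hmt : ∀ j ∈ s, t j = 0 → m j = 0)
    (hc : 0 < c) (hsum : ∑ j ∈ s, t j ≤ c) :
    ∑ j ∈ s, (Real.negMulLog (m j) + m j * Real.log (t j)) ≤
      Real.negMulLog (∑ j ∈ s, m j) + (∑ j ∈ s, m j) * Real.log c := by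
  set M := ∑ j ∈ s, m j with hM
  have hM0 : 0 ≤ M := Finset.sum_nonneg hm
  rcases hM0.eq_or_lt with h0 | hMpos
  · have hz : ∀ j ∈ s, m j = 0 := (Finset.sum_eq_zero_iff_of_nonneg hm).1 h0.symm
    rw [← h0, Finset.sum_eq_zero fun j hj => by simp [hz j hj]]
    simp
  have key : ∀ j ∈ s, Real.negMulLog (m j) + m j * Real.log (t j) ≤
      m j * (Real.log c - Real.log M) + (t j * (M / c) - m j) := by
    intro j hj
    rcases (hm j hj).eq_or_lt with h | hmj
    · rw [← h]
      have := mul_nonneg (ht j hj) (div_nonneg hM0 hc.le)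
      simpa using this
    have htj : 0 < t j := (ht j hj).lt_of_ne fun h => hmj.ne' (hmt j hj h.symm)
    have h1 := Real.log_le_sub_one_of_pos
      (show 0 < t j * M / (m j * c) by positivity)
    rw [Real.log_div (by positivity) (by positivity), Real.log_mul htj.ne' hMpos.ne',
      Real.log_mul hmj.ne' hc.ne'] at h1
    have h2 := mul_le_mul_of_nonneg_left h1 hmj.le
    have h3 : m j * (t j * M / (m j * c) - 1) = t j * (M / c) - m j := by
      field_simp
    rw [h3] at h2
    rw [Real.negMulLog]
    linarith
  refine (Finset.sum_le_sum key).trans ?_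
  rw [Finset.sum_add_distrib, Finset.sum_sub_distrib, ← Finset.sum_mul, ← Finset.sum_mul, ← hM]
  have : (∑ j ∈ s, t j) * (M / c) ≤ c * (M / c) := by gcongr
  rw [mul_div_cancel₀ _ hc.ne'] at this
  rw [Real.negMulLog]
  linarith

end Gibbs

section CoverEntropy

theorem exists_disjoint_refinement {Y ι : Type} [MeasurableSpace Y]
    (s : Finset ι) (E : ι → Set Y) (hE : ∀ j ∈ s, MeasurableSet (E j)) :
    ∃ D : ι → Set Y, (∀ j ∈ s, MeasurableSet (D j)) ∧ (∀ j ∈ s, D j ⊆ E j) ∧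
      (s : Set ι).PairwiseDisjoint D ∧ ⋃ j ∈ s, D j = ⋃ j ∈ s, E j := by
  classical
  induction s using Finset.induction_on with
  | empty => exact ⟨E, by simp, by simp, by simp, rfl⟩
  | insert i s hi ih =>
    obtain ⟨D, hDm, hDE, hDd, hDu⟩ := ih fun j hj => hE j (Finset.mem_insert_of_mem hj)
    have hne : ∀ j ∈ s, j ≠ i := fun j hj h => hi (h ▸ hj)
    have hU : MeasurableSet (⋃ j ∈ s, D j) := s.measurableSet_biUnion hDm
    have hagree : ∀ j ∈ s, Function.update D i (E i \ ⋃ j ∈ s, D j) j = D j := fun j hj =>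
      Function.update_of_ne (hne j hj) _ _
    refine ⟨Function.update D i (E i \ ⋃ j ∈ s, D j), ?_, ?_, ?_, ?_⟩
    · intro j hj
      rcases Finset.mem_insert.1 hj with rfl | hj
      · rw [Function.update_self]
        exact (hE _ (Finset.mem_insert_self _ _)).diff hU
      · rw [hagree j hj]
        exact hDm j hj
    · intro j hj
      rcases Finset.mem_insert.1 hj with rfl | hj
      · rw [Function.update_self]
        exact Set.sdiff_subset
      · rw [hagree j hj]
        exact hDE j hj
    · rw [Finset.coe_insert]
      refine Set.PairwiseDisjoint.insert ?_ ?_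
      · intro j hj k hk hjk
        change Disjoint _ _
        rw [hagree j hj, hagree k hk]
        exact hDd hj hk hjk
      · intro j hj _
        rw [Function.update_self, hagree j hj]
        exact Set.disjoint_sdiff_left.mono_right (Set.subset_biUnion_of_mem (u := D) hj)
    · rw [Finset.set_biUnion_insert, Finset.set_biUnion_insert, Function.update_self,
        Set.iUnion₂_congr hagree, Set.sdiff_union_self, hDu]

variable {Y : Type} [MeasurableSpace Y]

theorem measureReal_le_one {ν : Measure Y} (hν : ν Set.univ ≤ 1) (A : Set Y) : ν.real A ≤ 1 :=
  ENNReal.toReal_le_of_le_ofReal zero_le_one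
    (by simpa using (measure_mono (Set.subset_univ A)).trans hν)

theorem negMulLog_measureReal_nonneg {ν : Measure Y} (hν : ν Set.univ ≤ 1) (A : Set Y) :
    0 ≤ Real.negMulLog (ν.real A) :=
  Real.negMulLog_nonneg measureReal_nonneg (measureReal_le_one hν A)

theorem Hfin_nonneg {ν : Measure Y} (hν : ν Set.univ ≤ 1) (α : Finset (Set Y)) : 0 ≤ Hfin ν α :=
  Finset.sum_nonneg fun A _ => negMulLog_measureReal_nonneg hν A

theorem covEnt_nonneg {ν : Measure Y} (hν : ν Set.univ ≤ 1) (U : Finset (Set Y)) :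
    0 ≤ covEnt ν U := by
  refine Real.sInf_nonneg ?_
  rintro h ⟨α, -, -, rfl⟩
  exact Hfin_nonneg hν α

theorem covEnt_le_Hfin {ν : Measure Y} (hν : ν Set.univ ≤ 1) {U α : Finset (Set Y)}
    (hα : IsMPartition α) (hαU : Refines α U) : covEnt ν U ≤ Hfin ν α := by
  refine csInf_le ⟨0, ?_⟩ ⟨α, hα, hαU, rfl⟩
  rintro h ⟨β, -, -, rfl⟩
  exact Hfin_nonneg hν β

/-- A finite cover by measurable sets. -/
def IsMCover (U : Finset (Set Y)) : Prop :=
  (∀ A ∈ U, MeasurableSet A) ∧ ⋃₀ (U : Set (Set Y)) = Set.univ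

theorem covEnt_le_sum_of_partition {ι : Type} {ν : Measure Y} (hν : ν Set.univ ≤ 1)
    {U : Finset (Set Y)} (s : Finset ι) (E : ι → Set Y) (hE : ∀ j ∈ s, MeasurableSet (E j))
    (hd : (s : Set ι).PairwiseDisjoint E) (hu : ⋃ j ∈ s, E j = Set.univ)
    (hEU : ∀ j ∈ s, ∃ B ∈ U, E j ⊆ B) :
    covEnt ν U ≤ ∑ j ∈ s, Real.negMulLog (ν.real (E j)) := by
  classical
  refine (covEnt_le_Hfin hν (α := s.image E) ⟨?_, ?_, ?_⟩ ?_).trans ?_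
  · intro A hA
    obtain ⟨j, hj, rfl⟩ := Finset.mem_image.1 hA
    exact hE j hj
  · rw [Finset.coe_image, Set.sUnion_image]
    exact hu
  · intro A hA B hB hAB
    obtain ⟨j, hj, rfl⟩ := Finset.mem_image.1 hA
    obtain ⟨k, hk, rfl⟩ := Finset.mem_image.1 hB
    exact (hd hj hk fun h => hAB (h ▸ rfl)).inter_eq
  · intro A hA
    obtain ⟨j, hj, rfl⟩ := Finset.mem_image.1 hA
    exact hEU j hj
  · exact Finset.sum_image_le_of_nonneg fun A _ => negMulLog_measureReal_nonneg hν A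

theorem covEnt_le_sum {ι : Type} {ν : Measure Y} (hν : ν Set.univ ≤ 1)
    {U : Finset (Set Y)} (hU : IsMCover U) (s : Finset ι) (E : ι → Set Y)
    (hE : ∀ j ∈ s, MeasurableSet (E j)) (hd : (s : Set ι).PairwiseDisjoint E)
    (hu : ν (⋃ j ∈ s, E j)ᶜ = 0) (hEU : ∀ j ∈ s, ∃ B ∈ U, E j ⊆ B) :
    covEnt ν U ≤ ∑ j ∈ s, Real.negMulLog (ν.real (E j)) := by
  classical
  obtain ⟨D, hDm, hDU, hDd, hDu⟩ := exists_disjoint_refinement U id hU.1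
  set Z := ⋃ j ∈ s, E j with hZ
  have hZm : MeasurableSet Z := s.measurableSet_biUnion hE
  have h := covEnt_le_sum_of_partition hν (U := U) (s.disjSum U)
    (Sum.elim E fun A => D A \ Z) ?_ ?_ ?_ ?_
  · rw [Finset.sum_disjSum] at h
    refine h.trans_eq ?_
    simp only [Sum.elim_inl, Sum.elim_inr, add_eq_left]
    refine Finset.sum_eq_zero fun A _ => ?_
    have : ν (D A \ Z) = 0 := measure_mono_null (fun x hx => hx.2) hu
    simp [Measure.real, this]
  · rintro (j | A) hj
    · exact hE j (Finset.inl_mem_disjSum.1 hj)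
    · exact (hDm A (Finset.inr_mem_disjSum.1 hj)).diff hZm
  · rintro (j | A) hj (k | B) hk hjk
    · exact hd (Finset.inl_mem_disjSum.1 hj) (Finset.inl_mem_disjSum.1 hk)
        fun h => hjk (h ▸ rfl)
    · exact Set.disjoint_sdiff_right.mono_left
        (Set.subset_biUnion_of_mem (u := E) (Finset.inl_mem_disjSum.1 hj))
    · exact Set.disjoint_sdiff_left.mono_right
        (Set.subset_biUnion_of_mem (u := E) (Finset.inl_mem_disjSum.1 hk))
    · exact (hDd (Finset.inr_mem_disjSum.1 hj) (Finset.inr_mem_disjSum.1 hk)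
        fun h => hjk (h ▸ rfl)).mono Set.sdiff_subset Set.sdiff_subset
  · refine Set.eq_univ_of_forall fun x => ?_
    by_cases hx : x ∈ Z
    · obtain ⟨j, hj, hxj⟩ := Set.mem_iUnion₂.1 hx
      exact Set.mem_iUnion₂.2 ⟨Sum.inl j, Finset.inl_mem_disjSum.2 hj, hxj⟩
    · have : x ∈ ⋃ A ∈ U, D A := by
        rw [hDu]
        have := hU.2 ▸ Set.mem_univ x
        simpa using this
      obtain ⟨A, hA, hxA⟩ := Set.mem_iUnion₂.1 this
      exact Set.mem_iUnion₂.2 ⟨Sum.inr A, Finset.inr_mem_disjSum.2 hA, hxA, hx⟩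
  · rintro (j | A) hj
    · exact hEU j (Finset.inl_mem_disjSum.1 hj)
    · have hA := Finset.inr_mem_disjSum.1 hj
      exact ⟨A, hA, Set.sdiff_subset.trans (hDU A hA)⟩

theorem exists_partition_Hfin_lt (ν : Measure Y) {U : Finset (Set Y)} (hU : IsMCover U)
    {c : ℝ} (hc : covEnt ν U < c) :
    ∃ α : Finset (Set Y), IsMPartition α ∧ Refines α U ∧ Hfin ν α < c := by
  classical
  have hne : {h | ∃ α : Finset (Set Y), IsMPartition α ∧ Refines α U ∧ h = Hfin ν α}.Nonempty := by
    obtain ⟨D, hDm, hDU, hDd, hDu⟩ := exists_disjoint_refinement U id hU.1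
    refine ⟨_, U.image D, ⟨?_, ?_, ?_⟩, ?_, rfl⟩
    · intro A hA
      obtain ⟨j, hj, rfl⟩ := Finset.mem_image.1 hA
      exact hDm j hj
    · rw [Finset.coe_image, Set.sUnion_image, ← hU.2, Set.sUnion_eq_biUnion]
      exact hDu
    · intro A hA B hB hAB
      obtain ⟨j, hj, rfl⟩ := Finset.mem_image.1 hA
      obtain ⟨k, hk, rfl⟩ := Finset.mem_image.1 hB
      exact (hDd hj hk fun h => hAB (h ▸ rfl)).inter_eq
    · intro A hA
      obtain ⟨j, hj, rfl⟩ := Finset.mem_image.1 hA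
      exact ⟨j, hj, hDU j hj⟩
  obtain ⟨_, ⟨α, h1, h2, rfl⟩, h⟩ := exists_lt_of_csInf_lt hne hc
  exact ⟨α, h1, h2, h⟩

theorem IsMPartition.pairwiseDisjoint {α : Finset (Set Y)} (hα : IsMPartition α) :
    (α : Set (Set Y)).PairwiseDisjoint id := fun A hA B hB hAB =>
  Set.disjoint_iff_inter_eq_empty.2 (hα.2.2 A hA B hB hAB)

theorem covEnt_le_sum_restrict {ι : Type} {ν : Measure Y} (hν : ν Set.univ ≤ 1)
    {U : Finset (Set Y)} (hU : IsMCover U) (s : Finset ι) (D : ι → Set Y)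
    (hD : ∀ j ∈ s, MeasurableSet (D j)) (hd : (s : Set ι).PairwiseDisjoint D)
    (hu : ν (⋃ j ∈ s, D j)ᶜ = 0) :
    covEnt ν U ≤ ∑ j ∈ s, covEnt (ν.restrict (D j)) U := by
  classical
  refine le_of_forall_pos_lt_add fun ε hε => ?_
  set δ := ε / (s.card + 1) with hδ
  have hδ0 : 0 < δ := by positivity
  choose α hα hαU hαH using fun j =>
    exists_partition_Hfin_lt (ν.restrict (D j)) hU (lt_add_of_pos_right _ hδ0)
  have hle := covEnt_le_sum hν hU (s.sigma α) (fun p => D p.1 ∩ p.2) ?_ ?_ ?_ ?_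
  · rw [Finset.sum_sigma] at hle
    calc covEnt ν U ≤ _ := hle
      _ = ∑ j ∈ s, Hfin (ν.restrict (D j)) (α j) := by
        refine Finset.sum_congr rfl fun j hj => Finset.sum_congr rfl fun A hA => ?_
        rw [Measure.restrict_apply ((hα j).1 A hA), Set.inter_comm]
        rfl
      _ ≤ ∑ j ∈ s, (covEnt (ν.restrict (D j)) U + δ) :=
        Finset.sum_le_sum fun j _ => (hαH j).le
      _ < _ := by
        rw [Finset.sum_add_distrib, Finset.sum_const, nsmul_eq_mul]
        gcongr
        rw [hδ, mul_div_assoc', div_lt_iff₀ (by positivity)]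
        nlinarith
  · rintro ⟨j, A⟩ hp
    obtain ⟨hj, hA⟩ := Finset.mem_sigma.1 hp
    exact (hD j hj).inter ((hα j).1 A hA)
  · rintro ⟨j, A⟩ hp ⟨k, B⟩ hq hpq
    obtain ⟨hj, hA⟩ := Finset.mem_sigma.1 hp
    obtain ⟨hk, hB⟩ := Finset.mem_sigma.1 hq
    by_cases h : j = k
    · subst h
      have hAB : A ≠ B := fun h => hpq (h ▸ rfl)
      exact ((hα j).pairwiseDisjoint hA hB hAB).mono Set.inter_subset_right
        Set.inter_subset_right
    · exact (hd hj hk h).mono Set.inter_subset_left Set.inter_subset_left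
  · refine measure_mono_null (Set.compl_subset_compl.2 fun x hx => ?_) hu
    obtain ⟨j, hj, hxj⟩ := Set.mem_iUnion₂.1 hx
    obtain ⟨A, hA, hxA⟩ := Set.mem_sUnion.1 ((hα j).2.1 ▸ Set.mem_univ x)
    exact Set.mem_iUnion₂.2 ⟨⟨j, A⟩, Finset.mem_sigma.2 ⟨hj, hA⟩, hxj, hxA⟩
  · rintro ⟨j, A⟩ hp
    obtain ⟨B, hB, hAB⟩ := hαU j A (Finset.mem_sigma.1 hp).2
    exact ⟨B, hB, Set.inter_subset_right.trans hAB⟩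

theorem IsMPartition.sum_measureReal_inter {ν : Measure Y} [IsFiniteMeasure ν]
    {α : Finset (Set Y)} (hα : IsMPartition α) {B : Set Y} (hB : MeasurableSet B) :
    ∑ A ∈ α, ν.real (B ∩ A) = ν.real B := by
  rw [← measureReal_biUnion_finset (f := fun A => B ∩ A)
    (hα.pairwiseDisjoint.mono fun A => Set.inter_subset_right)
    fun A hA => hB.inter (hα.1 A hA), ← Set.inter_iUnion₂]
  have := hα.2.1
  simp only [Set.sUnion_eq_biUnion, Finset.mem_coe] at this
  rw [this, Set.inter_univ]

theorem covEnt_le_add {ν : Measure Y} [IsProbabilityMeasure ν] {U U₁ U₂ : Finset (Set Y)}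
    (h₁ : IsMCover U₁) (h₂ : IsMCover U₂)
    (h : ∀ A ∈ U₁, ∀ B ∈ U₂, ∃ C ∈ U, A ∩ B ⊆ C) :
    covEnt ν U ≤ covEnt ν U₁ + covEnt ν U₂ := by
  classical
  refine le_of_forall_pos_lt_add fun ε hε => ?_
  obtain ⟨α, hα, hαU, hαH⟩ := exists_partition_Hfin_lt ν h₁ (lt_add_of_pos_right _ (half_pos hε))
  obtain ⟨β, hβ, hβU, hβH⟩ := exists_partition_Hfin_lt ν h₂ (lt_add_of_pos_right _ (half_pos hε))
  have hν : ν Set.univ ≤ 1 := by simp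
  have hle := covEnt_le_sum_of_partition hν (U := U) (α ×ˢ β) (fun p => p.1 ∩ p.2) ?_ ?_ ?_ ?_
  · rw [Finset.sum_product] at hle
    have hg : ∀ A ∈ α, ∑ B ∈ β, Real.negMulLog (ν.real (A ∩ B)) ≤
        Real.negMulLog (ν.real A) - ∑ B ∈ β, ν.real (A ∩ B) * Real.log (ν.real B) := by
      intro A hA
      have := sum_negMulLog_add_mul_log_le β (fun B => ν.real (A ∩ B)) (fun B => ν.real B)
        (c := 1) (fun _ _ => measureReal_nonneg) (fun _ _ => measureReal_nonneg)
        (fun B _ hB => measureReal_mono_null Set.inter_subset_right hB) one_pos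
        (by
          have := hβ.sum_measureReal_inter (ν := ν) MeasurableSet.univ
          simp only [Set.univ_inter, probReal_univ] at this
          exact this.le)
      rw [Finset.sum_add_distrib, hβ.sum_measureReal_inter (hα.1 A hA)] at this
      simp only [Real.log_one, mul_zero, add_zero] at this
      linarith
    have hs : ∑ A ∈ α, ∑ B ∈ β, ν.real (A ∩ B) * Real.log (ν.real B) = - Hfin ν β := by
      rw [Finset.sum_comm, Hfin, ← Finset.sum_neg_distrib]
      refine Finset.sum_congr rfl fun B hB => ?_
      rw [← Finset.sum_mul]
      simp_rw [Set.inter_comm _ B]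
      rw [hα.sum_measureReal_inter (hβ.1 B hB)]
      simp [Real.negMulLog, Measure.real]
    have := Finset.sum_le_sum hg
    rw [Finset.sum_sub_distrib, hs] at this
    change _ ≤ Hfin ν α - _ at this
    linarith
  · rintro ⟨A, B⟩ hp
    obtain ⟨hA, hB⟩ := Finset.mem_product.1 hp
    exact (hα.1 A hA).inter (hβ.1 B hB)
  · rintro ⟨A, B⟩ hp ⟨A', B'⟩ hq hpq
    obtain ⟨hA, hB⟩ := Finset.mem_product.1 hp
    obtain ⟨hA', hB'⟩ := Finset.mem_product.1 hq
    by_cases h : A = A'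
    · subst h
      have hAB : B ≠ B' := fun h => hpq (h ▸ rfl)
      exact (hβ.pairwiseDisjoint hB hB' hAB).mono Set.inter_subset_right Set.inter_subset_right
    · exact (hα.pairwiseDisjoint hA hA' h).mono Set.inter_subset_left Set.inter_subset_left
  · refine Set.eq_univ_of_forall fun x => ?_
    obtain ⟨A, hA, hxA⟩ := Set.mem_sUnion.1 (hα.2.1 ▸ Set.mem_univ x)
    obtain ⟨B, hB, hxB⟩ := Set.mem_sUnion.1 (hβ.2.1 ▸ Set.mem_univ x)
    exact Set.mem_iUnion₂.2 ⟨(A, B), Finset.mem_product.2 ⟨hA, hB⟩, hxA, hxB⟩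
  · rintro ⟨A, B⟩ hp
    obtain ⟨hA, hB⟩ := Finset.mem_product.1 hp
    obtain ⟨A', hA', hAA'⟩ := hαU A hA
    obtain ⟨B', hB', hBB'⟩ := hβU B hB
    obtain ⟨C, hC, hABC⟩ := h A' hA' B' hB'
    exact ⟨C, hC, (Set.inter_subset_inter hAA' hBB').trans hABC⟩

theorem covEnt_le_of_measurePreserving {ν : Measure Y} [IsProbabilityMeasure ν]
    {T : Y → Y} (hT : MeasurePreserving T ν ν) {U U' : Finset (Set Y)} (hU : IsMCover U)
    (h : ∀ A ∈ U, ∃ C ∈ U', T ⁻¹' A ⊆ C) : covEnt ν U' ≤ covEnt ν U := by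
  refine le_of_forall_gt_imp_ge_of_dense fun c hc => ?_
  obtain ⟨α, hα, hαU, hαH⟩ := exists_partition_Hfin_lt ν hU hc
  refine (covEnt_le_sum_of_partition (by simp) (U := U') α (fun A => T ⁻¹' A) ?_ ?_ ?_ ?_).trans
    (le_of_eq_of_le ?_ hαH.le)
  · exact fun A hA => hT.measurable (hα.1 A hA)
  · exact fun A hA B hB hAB => (hα.pairwiseDisjoint hA hB hAB).preimage T
  · refine Set.eq_univ_of_forall fun x => ?_
    obtain ⟨A, hA, hxA⟩ := Set.mem_sUnion.1 (hα.2.1 ▸ Set.mem_univ (T x))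
    exact Set.mem_iUnion₂.2 ⟨A, hA, hxA⟩
  · intro A hA
    obtain ⟨B, hB, hAB⟩ := hαU A hA
    obtain ⟨C, hC, hBC⟩ := h B hB
    exact ⟨C, hC, (Set.preimage_mono hAB).trans hBC⟩
  · exact Finset.sum_congr rfl fun A hA => by
      rw [hT.measureReal_preimage (hα.1 A hA).nullMeasurableSet, Measure.real]

end CoverEntropy

section CoverJoin

variable {G : Type} [Group G]

theorem IsFinOpenCover.isMCover {S : GSystem G} {U : Finset (Set S.carrier)}
    (hU : IsFinOpenCover S U) : IsMCover U :=
  ⟨fun A hA => (hU.1 A hA).measurableSet, hU.2⟩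

variable [DecidableEq G] (S : GSystem G) {U : Finset (Set S.carrier)}

theorem subset_coverJoin_iff {F : Finset G} {B : Set S.carrier} :
    (∃ C ∈ coverJoin S U F, B ⊆ C) ↔ ∀ g ∈ F, ∃ A ∈ U, B ⊆ S.act g ⁻¹' A := by
  classical
  constructor
  · rintro ⟨C, hC, hBC⟩ g hg
    obtain ⟨c, hc, rfl⟩ := Finset.mem_image.1 hC
    exact ⟨c g hg, Finset.mem_pi.1 hc g hg, hBC.trans (Set.iInter₂_subset g hg)⟩
  · intro h
    choose c hc hBc using h
    exact ⟨_, Finset.mem_image.2 ⟨c, Finset.mem_pi.2 hc, rfl⟩, Set.subset_iInter₂ hBc⟩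

theorem isFinOpenCover_coverJoin (hU : IsFinOpenCover S U) (F : Finset G) :
    IsFinOpenCover S (coverJoin S U F) := by
  classical
  constructor
  · intro A hA
    obtain ⟨c, hc, rfl⟩ := Finset.mem_image.1 hA
    have h : ∀ g, IsOpen (⋂ (h : g ∈ F), S.act g ⁻¹' c g h) := fun g =>
      isOpen_iInter_of_finite fun h =>
        (hU.1 _ (Finset.mem_pi.1 hc g h)).preimage (S.cont_act g)
    have h2 : ⋂ g, ⋂ (h : g ∈ F), S.act g ⁻¹' c g h =
        ⋂ g ∈ F, ⋂ (h : g ∈ F), S.act g ⁻¹' c g h := by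
      ext x
      simp
    rw [h2]
    exact isOpen_biInter_finset fun g _ => h g
  · refine Set.eq_univ_of_forall fun x => ?_
    obtain ⟨C, hC, hxC⟩ := (subset_coverJoin_iff S (U := U) (F := F) (B := {x})).2 fun g _ => by
      obtain ⟨A, hA, hxA⟩ := Set.mem_sUnion.1 (hU.2 ▸ Set.mem_univ (S.act g x))
      exact ⟨A, hA, by simpa using hxA⟩
    exact ⟨C, hC, hxC rfl⟩

open Pointwise in
theorem tendsto_hMinus {Fn : ℕ → Finset G} (hFn : IsFolner G Fn) (hU : IsFinOpenCover S U)
    {ν : Measure S.carrier} (hν : IsInvProb S ν) :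
    Tendsto (fun n => covEnt ν (coverJoin S U (Fn n)) / ((Fn n).card : ℝ)) atTop
      (nhds (hMinus S Fn ν U)) := by
  have := hν.1
  have hM := fun F => (isFinOpenCover_coverJoin S hU F).isMCover
  refine tendsto_limsup_of_subadditive hFn (h := fun F => covEnt ν (coverJoin S U F))
    (fun F => covEnt_nonneg (by simp) _) ?_ (fun A B => ?_) fun A g => ?_
  · refine (covEnt_le_sum_of_partition (ι := Unit) (by simp) Finset.univ
      (fun _ => Set.univ) (by simp) ?_ (by simp [Set.iUnion_const]) ?_).trans (by simp)
    · exact Set.subsingleton_of_subsingleton.pairwise _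
    · exact fun _ _ => (subset_coverJoin_iff S).2 (by simp)
  · refine covEnt_le_add (hM A) (hM B) fun C hC D hD => (subset_coverJoin_iff S).2 fun g hg => ?_
    rcases Finset.mem_union.1 hg with hg | hg
    · obtain ⟨E, hE, hCE⟩ := (subset_coverJoin_iff S).1 ⟨C, hC, subset_rfl⟩ g hg
      exact ⟨E, hE, Set.inter_subset_left.trans hCE⟩
    · obtain ⟨E, hE, hDE⟩ := (subset_coverJoin_iff S).1 ⟨D, hD, subset_rfl⟩ g hg
      exact ⟨E, hE, Set.inter_subset_right.trans hDE⟩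
  · refine covEnt_le_of_measurePreserving ⟨(S.cont_act g).measurable, hν.2 g⟩ (hM A)
      fun C hC => (subset_coverJoin_iff S).2 fun k hk => ?_
    obtain ⟨a, ha, b, hb, rfl⟩ := Finset.mem_mul.1 hk
    obtain rfl := Finset.mem_singleton.1 hb
    obtain ⟨E, hE, hCE⟩ := (subset_coverJoin_iff S).1 ⟨C, hC, subset_rfl⟩ a ha
    refine ⟨E, hE, fun x hx => ?_⟩
    rw [Set.mem_preimage, S.mul_act]
    exact hCE hx

end CoverJoin

end WPP

namespace WPP

open MeasureTheory

section FiniteEstimate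

variable {G : Type} [Group G] (X : ℕ → GSystem G) (π : ∀ i, FactorMap (X i) (X (i + 1)))

theorem continuous_chainMap (i : ℕ) : Continuous (chainMap X π i) := by
  induction i with
  | zero => exact continuous_id
  | succ i ih => exact (π i).cont.comp ih

theorem chainMap_act (i : ℕ) (g : G) (x : (X 0).carrier) :
    chainMap X π i ((X 0).act g x) = (X i).act g (chainMap X π i x) := by
  induction i with
  | zero => rfl
  | succ i ih =>
    change (π i).toFun (chainMap X π i ((X 0).act g x)) = _
    rw [ih, (π i).equiv]
    rfl

theorem exists_factor_chainMap {k i : ℕ} (h : k ≤ i) :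
    ∃ φ : (X k).carrier → (X i).carrier, Continuous φ ∧
      φ ∘ chainMap X π k = chainMap X π i := by
  induction i, h using Nat.le_induction with
  | base => exact ⟨id, continuous_id, rfl⟩
  | succ i _ ih =>
    obtain ⟨φ, hφ, hφk⟩ := ih
    exact ⟨(π i).toFun ∘ φ, (π i).cont.comp hφ, by rw [Function.comp_assoc, hφk]; rfl⟩

theorem isInvProb_map_chainMap {μ : Measure (X 0).carrier} (hμ : IsInvProb (X 0) μ) (i : ℕ) :
    IsInvProb (X i) (μ.map (chainMap X π i)) := by
  have := hμ.1
  have hm := (continuous_chainMap X π i).measurable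
  refine ⟨Measure.isProbabilityMeasure_map hm.aemeasurable, fun g => ?_⟩
  rw [Measure.map_map ((X i).cont_act g).measurable hm]
  conv_rhs => rw [← hμ.2 g]
  rw [Measure.map_map hm ((X 0).cont_act g).measurable]
  congr 1
  ext x
  exact (chainMap_act X π i g x).symm

theorem continuous_birk (S : GSystem G) {f : S.carrier → ℝ} (hf : Continuous f) (F : Finset G) :
    Continuous (birk S f F) :=
  continuous_finsetSum F fun g _ => hf.comp (S.cont_act g)

theorem integral_birk (S : GSystem G) {f : S.carrier → ℝ} (hf : Continuous f) (F : Finset G)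
    {μ : Measure S.carrier} (hμ : IsInvProb S μ) :
    ∫ x, birk S f F x ∂μ = F.card * ∫ x, f x ∂μ := by
  have := hμ.1
  have hc : ∀ g, Continuous fun x => f (S.act g x) := fun g => hf.comp (S.cont_act g)
  unfold birk
  rw [integral_finsetSum F fun g _ =>
    (hc g).integrable_of_hasCompactSupport (HasCompactSupport.of_compactSpace _)]
  rw [Finset.sum_congr rfl fun g _ => ?_, Finset.sum_const, nsmul_eq_mul]
  conv_rhs => rw [← hμ.2 g]
  exact (integral_map (S.cont_act g).measurable.aemeasurable hf.aestronglyMeasurable).symm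

theorem wt_nonneg {a : ℕ → ℝ} {r : ℕ} (ha : ∀ i < r - 1, a i ∈ Set.Icc (0 : ℝ) 1) {i : ℕ}
    (hi : i < r) : 0 ≤ wt a r i := by
  unfold wt
  split_ifs with h
  · exact Finset.prod_nonneg fun j hj => (ha j (Finset.mem_range.1 hj)).1
  · refine mul_nonneg (sub_nonneg.2 (ha _ (by omega)).2) (Finset.prod_nonneg fun j hj => ?_)
    exact (ha j (Finset.mem_Ico.1 hj).2).1

theorem wt_succ_of_le (a : ℕ → ℝ) {i k : ℕ} (hk : k ≤ i) :
    wt a (i + 1 + 1) k = a i * wt a (i + 1) k := by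
  unfold wt
  split_ifs with h
  · simp [Finset.prod_range_succ, mul_comm]
  · rw [Nat.add_sub_cancel, Nat.add_sub_cancel, Finset.prod_Ico_succ_top hk]
    ring

theorem wt_succ_self (a : ℕ → ℝ) (i : ℕ) : wt a (i + 1 + 1) (i + 1) = 1 - a i := by
  simp [wt]

variable [DecidableEq G] {a : ℕ → ℝ} {f : (X 0).carrier → ℝ} {F : Finset G}
  {Us : ∀ i, Finset (Set (X i).carrier)}

theorem wPU_nonneg (i : ℕ) (Ω : Set (X i).carrier) : 0 ≤ wPU X π a f F Us i Ω := by
  induction i with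
  | zero =>
    refine Real.sInf_nonneg ?_
    rintro s ⟨V, W, -, -, -, -, rfl⟩
    exact Finset.sum_nonneg fun A _ => (Real.exp_pos _).le
  | succ i ih =>
    refine Real.sInf_nonneg ?_
    rintro s ⟨V, W, -, -, -, -, rfl⟩
    exact Finset.sum_nonneg fun A _ => Real.rpow_nonneg (ih _) _

theorem exists_cover_zero (h0 : IsFinOpenCover (X 0) (Us 0)) {Ω : Set (X 0).carrier} {c : ℝ}
    (hc : wPU X π a f F Us 0 Ω < c) :
    ∃ V : Finset (Set (X 0).carrier), Refines V (coverJoin (X 0) (Us 0) F) ∧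
      Ω ⊆ ⋃₀ (V : Set (Set (X 0).carrier)) ∧
      ∑ A ∈ V, Real.exp (sSup (birk (X 0) f F '' A)) < c := by
  have hU := isFinOpenCover_coverJoin (X 0) h0 F
  obtain ⟨_, ⟨V, W, -, hWU, hVW, hΩ, rfl⟩, hlt⟩ := exists_lt_of_csInf_lt
    (by exact ⟨_, _, _, hU.2, fun A hA => ⟨A, hA, subset_rfl⟩, subset_rfl,
      hU.2 ▸ Set.subset_univ Ω, rfl⟩) hc
  exact ⟨V, fun A hA => hWU A (hVW hA), hΩ, hlt⟩

theorem exists_cover_succ {i : ℕ} (h0 : IsFinOpenCover (X (i + 1)) (Us (i + 1)))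
    {Ω : Set (X (i + 1)).carrier} {c : ℝ} (hc : wPU X π a f F Us (i + 1) Ω < c) :
    ∃ V : Finset (Set (X (i + 1)).carrier), Refines V (coverJoin (X (i + 1)) (Us (i + 1)) F) ∧
      Ω ⊆ ⋃₀ (V : Set (Set (X (i + 1)).carrier)) ∧
      ∑ A ∈ V, (wPU X π a f F Us i ((π i).toFun ⁻¹' A)) ^ (a i) < c := by
  have hU := isFinOpenCover_coverJoin (X (i + 1)) h0 F
  obtain ⟨_, ⟨V, W, -, hWU, hVW, hΩ, rfl⟩, hlt⟩ := exists_lt_of_csInf_lt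
    (by exact ⟨_, _, _, hU.2, fun A hA => ⟨A, hA, subset_rfl⟩, subset_rfl,
      hU.2 ▸ Set.subset_univ Ω, rfl⟩) hc
  exact ⟨V, fun A hA => hWU A (hVW hA), hΩ, hlt⟩

theorem integral_eq_sum_restrict {Y ι : Type} [MeasurableSpace Y] {ν : Measure Y} {h : Y → ℝ}
    (hh : Integrable h ν) (s : Finset ι) (D : ι → Set Y) (hD : ∀ j ∈ s, MeasurableSet (D j))
    (hd : (s : Set ι).PairwiseDisjoint D) (hu : ν (⋃ j ∈ s, D j)ᶜ = 0) :
    ∫ x, h x ∂ν = ∑ j ∈ s, ∫ x in D j, h x ∂ν := by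
  rw [← integral_biUnion_finset s hD hd fun j _ => hh.integrableOn,
    Measure.restrict_eq_self_of_ae_mem (s := ⋃ j ∈ s, D j) (mem_ae_iff.2 hu)]

theorem measureReal_univ_eq_sum {Y ι : Type} [MeasurableSpace Y] {ν : Measure Y}
    [IsFiniteMeasure ν] (s : Finset ι) (D : ι → Set Y) (hD : ∀ j ∈ s, MeasurableSet (D j))
    (hd : (s : Set ι).PairwiseDisjoint D) (hu : ν (⋃ j ∈ s, D j)ᶜ = 0) :
    ∑ j ∈ s, ν.real (D j) = ν.real Set.univ := by
  rw [← measureReal_biUnion_finset hd hD]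
  exact measureReal_congr (ae_eq_univ.2 hu)

theorem exists_open_bound_zero (hf : Continuous f) (h0 : IsFinOpenCover (X 0) (Us 0))
    {Ω : Set (X 0).carrier} {c : ℝ} (hc : wPU X π a f F Us 0 Ω < c) :
    ∃ O : Set (X 0).carrier, IsOpen O ∧ Ω ⊆ O ∧ ∀ ν : Measure (X 0).carrier,
      ν Set.univ ≤ 1 → ν Oᶜ = 0 →
      covEnt ν (coverJoin (X 0) (Us 0) F) + ∫ x, birk (X 0) f F x ∂ν ≤
        Real.negMulLog (ν.real Set.univ) + ν.real Set.univ * Real.log c := by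
  obtain ⟨V, hVU, hΩ, hlt⟩ := exists_cover_zero X π h0 hc
  have hcpos : 0 < c := (wPU_nonneg X π 0 Ω).trans_lt hc
  have hU := isFinOpenCover_coverJoin (X 0) h0 F
  have hbc := continuous_birk (X 0) hf F
  choose! B hBU hAB using hVU
  obtain ⟨ε, hεlt, hε⟩ : ∃ ε : ℝ, (∑ A ∈ V, Real.exp (sSup (birk (X 0) f F '' A) + ε)) < c ∧
      ε ∈ Set.Ioi 0 := by
    have hcont : Continuous fun ε : ℝ =>
      ∑ A ∈ V, Real.exp (sSup (birk (X 0) f F '' A) + ε) := by fun_prop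
    have hlim := (hcont.tendsto 0).mono_left (nhdsWithin_le_nhds (s := Set.Ioi 0))
    simp only [add_zero] at hlim
    exact ((hlim.eventually_lt_const hlt).and self_mem_nhdsWithin).exists
  set t : Set (X 0).carrier → ℝ := fun A => sSup (birk (X 0) f F '' A) + ε with ht
  set E : Set (X 0).carrier → Set (X 0).carrier := fun A => B A ∩ birk (X 0) f F ⁻¹' Set.Iio (t A)
    with hE
  have hEo : ∀ A ∈ V, IsOpen (E A) := fun A hA =>
    (hU.1 _ (hBU A hA)).inter (isOpen_Iio.preimage hbc)
  refine ⟨⋃ A ∈ V, E A, isOpen_biUnion hEo, fun x hx => ?_, fun ν hν hνO => ?_⟩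
  · obtain ⟨A, hA, hxA⟩ := Set.mem_sUnion.1 (hΩ hx)
    refine Set.mem_iUnion₂.2 ⟨A, hA, hAB A hA hxA, ?_⟩
    have : birk (X 0) f F x ≤ sSup (birk (X 0) f F '' A) :=
      le_csSup ((isCompact_range hbc).bddAbove.mono (Set.image_subset_range _ _))
        (Set.mem_image_of_mem _ hxA)
    exact this.trans_lt (lt_add_of_pos_right _ hε)
  have : IsFiniteMeasure ν := ⟨hν.trans_lt ENNReal.one_lt_top⟩
  obtain ⟨D, hDm, hDE, hDd, hDu⟩ :=
    exists_disjoint_refinement V E fun A hA => (hEo A hA).measurableSet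
  rw [← hDu] at hνO
  have hint : Integrable (birk (X 0) f F) ν :=
    hbc.integrable_of_hasCompactSupport (HasCompactSupport.of_compactSpace _)
  have h1 := covEnt_le_sum hν hU.isMCover V D hDm hDd hνO fun A hA =>
    ⟨B A, hBU A hA, (hDE A hA).trans Set.inter_subset_left⟩
  have h2 : ∫ x, birk (X 0) f F x ∂ν ≤ ∑ A ∈ V, ν.real (D A) * t A := by
    rw [integral_eq_sum_restrict hint V D hDm hDd hνO]
    refine Finset.sum_le_sum fun A hA => ?_
    calc ∫ x in D A, birk (X 0) f F x ∂ν ≤ ∫ _ in D A, t A ∂ν :=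
          setIntegral_mono_on hint.integrableOn (integrable_const _) (hDm A hA)
            fun x hx => (hDE A hA hx).2.le
      _ = _ := by simp
  have h3 := sum_negMulLog_add_mul_log_le V (fun A => ν.real (D A)) (fun A => Real.exp (t A))
    (fun _ _ => measureReal_nonneg) (fun _ _ => (Real.exp_pos _).le)
    (fun A _ h => absurd h (Real.exp_pos _).ne') hcpos hεlt.le
  simp only [Real.log_exp, Finset.sum_add_distrib] at h3
  rw [measureReal_univ_eq_sum V D hDm hDd hνO] at h3
  linarith

theorem exists_open_bound (hf : Continuous f) (i : ℕ)
    (hUs : ∀ k ≤ i, IsFinOpenCover (X k) (Us k)) (ha : ∀ k < i, a k ∈ Set.Icc (0 : ℝ) 1)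
    {Ω : Set (X i).carrier} {c : ℝ} (hc : wPU X π a f F Us i Ω < c) :
    ∃ O : Set (X i).carrier, IsOpen O ∧ Ω ⊆ O ∧ ∀ ν : Measure (X 0).carrier,
      ν Set.univ ≤ 1 → ν (chainMap X π i ⁻¹' Oᶜ) = 0 →
      ∑ k ∈ Finset.range (i + 1),
          wt a (i + 1) k * covEnt (ν.map (chainMap X π k)) (coverJoin (X k) (Us k) F) +
        wt a (i + 1) 0 * ∫ x, birk (X 0) f F x ∂ν ≤
        Real.negMulLog (ν.real Set.univ) + ν.real Set.univ * Real.log c := by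
  induction i generalizing c with
  | zero =>
    obtain ⟨O, hO, hΩ, h⟩ := exists_open_bound_zero X π hf (hUs 0 le_rfl) hc
    refine ⟨O, hO, hΩ, fun ν hν hνO => ?_⟩
    have := h ν hν hνO
    simpa [wt, chainMap, Measure.map_id] using this
  | succ i ih =>
    obtain ⟨V, hVU, hΩ, hlt⟩ := exists_cover_succ X π (hUs (i + 1) le_rfl) hc
    have hcpos : 0 < c := (wPU_nonneg X π (i + 1) Ω).trans_lt hc
    obtain ⟨hai0, hai1⟩ := ha i (Nat.lt_succ_self i)
    have hU := isFinOpenCover_coverJoin (X (i + 1)) (hUs (i + 1) le_rfl) F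
    choose! B hBU hAB using hVU
    set p : Set (X (i + 1)).carrier → ℝ := fun A => wPU X π a f F Us i ((π i).toFun ⁻¹' A)
      with hp
    have hp0 : ∀ A, 0 ≤ p A := fun A => wPU_nonneg X π i _
    obtain ⟨ε, hεlt, hε⟩ : ∃ ε : ℝ, (∑ A ∈ V, (p A + ε) ^ (a i)) < c ∧ ε ∈ Set.Ioi 0 := by
      have hcont : Tendsto (fun ε : ℝ => ∑ A ∈ V, (p A + ε) ^ (a i)) (nhds 0)
          (nhds (∑ A ∈ V, (p A) ^ (a i))) := by
        refine tendsto_finsetSum V fun A _ => ?_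
        have h1 : Tendsto (fun ε : ℝ => p A + ε) (nhds 0) (nhds (p A)) := by
          simpa using (continuous_const_add (p A)).tendsto 0
        exact (Real.continuousAt_rpow_const (p A) (a i) (Or.inr hai0)).tendsto.comp h1
      exact (((hcont.mono_left (nhdsWithin_le_nhds (s := Set.Ioi 0))).eventually_lt_const hlt).and
        self_mem_nhdsWithin).exists
    have hpos : ∀ A, 0 < p A + ε := fun A => add_pos_of_nonneg_of_pos (hp0 A) hε
    choose O hOo hOp hOb using fun A : Set (X (i + 1)).carrier =>
      ih (fun k hk => hUs k (hk.trans (Nat.le_succ i)))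
        (fun k hk => ha k (hk.trans (Nat.lt_succ_self i)))
        (show wPU X π a f F Us i ((π i).toFun ⁻¹' A) < p A + ε from lt_add_of_pos_right _ hε)
    set E : Set (X (i + 1)).carrier → Set (X (i + 1)).carrier := fun A =>
      B A ∩ ((π i).toFun '' (O A)ᶜ)ᶜ with hE
    have hEo : ∀ A ∈ V, IsOpen (E A) := fun A hA =>
      (hU.1 _ (hBU A hA)).inter
        ((π i).cont.isClosedMap _ (hOo A).isClosed_compl).isOpen_compl
    refine ⟨⋃ A ∈ V, E A, isOpen_biUnion hEo, fun x hx => ?_, fun ν hν hνO => ?_⟩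
    · obtain ⟨A, hA, hxA⟩ := Set.mem_sUnion.1 (hΩ hx)
      refine Set.mem_iUnion₂.2 ⟨A, hA, hAB A hA hxA, ?_⟩
      rintro ⟨y, hy, rfl⟩
      exact hy (hOp A hxA)
    have : IsFiniteMeasure ν := ⟨hν.trans_lt ENNReal.one_lt_top⟩
    obtain ⟨D, hDm, hDE, hDd, hDu⟩ :=
      exists_disjoint_refinement V E fun A hA => (hEo A hA).measurableSet
    rw [← hDu] at hνO
    have hcm : ∀ k, Measurable (chainMap X π k) := fun k =>
      (continuous_chainMap X π k).measurable
    set D' : Set (X (i + 1)).carrier → Set (X 0).carrier := fun A =>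
      chainMap X π (i + 1) ⁻¹' D A with hD'
    have hDm' : ∀ A ∈ V, MeasurableSet (D' A) := fun A hA => hcm _ (hDm A hA)
    have hDd' : (V : Set (Set (X (i + 1)).carrier)).PairwiseDisjoint D' :=
      fun A hA A' hA' hne => (hDd hA hA' hne).preimage _
    have hνO' : ν (⋃ A ∈ V, D' A)ᶜ = 0 := by
      rw [← hνO, Set.preimage_compl, Set.preimage_iUnion₂]
    have hmap : ∀ k, (ν.map (chainMap X π k)) Set.univ ≤ 1 := fun k => by
      rwa [Measure.map_apply (hcm k) MeasurableSet.univ, Set.preimage_univ]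
    have hint : Integrable (birk (X 0) f F) ν := (continuous_birk (X 0) hf
      F).integrable_of_hasCompactSupport (HasCompactSupport.of_compactSpace _)
    have htop : covEnt (ν.map (chainMap X π (i + 1))) (coverJoin (X (i + 1)) (Us (i + 1)) F) ≤
        ∑ A ∈ V, Real.negMulLog (ν.real (D' A)) := by
      refine (covEnt_le_sum (hmap _) hU.isMCover V D hDm hDd ?_ fun A hA =>
        ⟨B A, hBU A hA, (hDE A hA).trans Set.inter_subset_left⟩).trans_eq ?_
      · rwa [Measure.map_apply (hcm _) (V.measurableSet_biUnion hDm).compl]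
      · exact Finset.sum_congr rfl fun A hA => by
          rw [map_measureReal_apply (hcm _) (hDm A hA)]
    have hlow : ∀ k ∈ Finset.range (i + 1),
        covEnt (ν.map (chainMap X π k)) (coverJoin (X k) (Us k) F) ≤
          ∑ A ∈ V, covEnt ((ν.restrict (D' A)).map (chainMap X π k))
            (coverJoin (X k) (Us k) F) := by
      intro k hk
      have hki : k ≤ i := Nat.lt_succ_iff.1 (Finset.mem_range.1 hk)
      obtain ⟨φ, hφ, hφk⟩ := exists_factor_chainMap X π (hki.trans (Nat.le_succ i))
      have hpre : ∀ A, chainMap X π k ⁻¹' (φ ⁻¹' D A) = D' A := fun A => by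
        rw [← Set.preimage_comp, hφk]
      refine (covEnt_le_sum_restrict (hmap k)
        (isFinOpenCover_coverJoin (X k) (hUs k (hki.trans (Nat.le_succ i))) F).isMCover V
        (fun A => φ ⁻¹' D A) (fun A hA => hφ.measurable (hDm A hA))
        (fun A hA A' hA' hne => (hDd hA hA' hne).preimage _) ?_).trans_eq ?_
      · rw [Measure.map_apply (hcm _)
          (V.measurableSet_biUnion fun A hA => hφ.measurable (hDm A hA)).compl,
          Set.preimage_compl, Set.preimage_iUnion₂]
        simpa only [hpre] using hνO'
      · exact Finset.sum_congr rfl fun A hA => by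
          rw [Measure.restrict_map (hcm k) (hφ.measurable (hDm A hA)), hpre]
    have hIH : ∀ A ∈ V, ∑ k ∈ Finset.range (i + 1), wt a (i + 1) k *
          covEnt ((ν.restrict (D' A)).map (chainMap X π k)) (coverJoin (X k) (Us k) F) +
        wt a (i + 1) 0 * ∫ x in D' A, birk (X 0) f F x ∂ν ≤
        Real.negMulLog (ν.real (D' A)) + ν.real (D' A) * Real.log (p A + ε) := by
      intro A hA
      have := hOb A (ν.restrict (D' A))
        (by rw [Measure.restrict_apply_univ]; exact (measure_mono (Set.subset_univ _)).trans hν) ?_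
      · simpa [measureReal_restrict_apply_univ] using this
      · rw [Measure.restrict_apply' (hDm' A hA)]
        convert measure_empty (μ := ν)
        refine Set.eq_empty_of_forall_notMem fun x hx => ?_
        exact (hDE A hA hx.2).2 ⟨_, hx.1, rfl⟩
    have hG := sum_negMulLog_add_mul_log_le V (fun A => ν.real (D' A))
      (fun A => (p A + ε) ^ (a i)) (fun _ _ => measureReal_nonneg)
      (fun A _ => (Real.rpow_pos_of_pos (hpos A) _).le)
      (fun A _ h => absurd h (Real.rpow_pos_of_pos (hpos A) _).ne') hcpos hεlt.le
    rw [measureReal_univ_eq_sum V D' hDm' hDd' hνO'] at hG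
    refine le_trans ?_ hG
    have hsum : ∑ k ∈ Finset.range (i + 1),
          wt a (i + 1) k * covEnt (ν.map (chainMap X π k)) (coverJoin (X k) (Us k) F) +
        wt a (i + 1) 0 * ∫ x, birk (X 0) f F x ∂ν ≤
        ∑ A ∈ V, (Real.negMulLog (ν.real (D' A)) + ν.real (D' A) * Real.log (p A + ε)) := by
      refine le_trans ?_ (Finset.sum_le_sum hIH)
      rw [Finset.sum_add_distrib, ← Finset.mul_sum,
        ← integral_eq_sum_restrict hint V D' hDm' hDd' hνO', Finset.sum_comm]
      gcongr with k hk
      rw [← Finset.mul_sum]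
      exact mul_le_mul_of_nonneg_left (hlow k hk)
        (wt_nonneg (fun j hj => ha j (by omega)) (Finset.mem_range.1 hk))
    have hmul := mul_le_mul_of_nonneg_left hsum hai0
    have htop' := mul_le_mul_of_nonneg_left htop (sub_nonneg.2 hai1)
    rw [Finset.sum_range_succ, wt_succ_self, wt_succ_of_le a (Nat.zero_le i),
      Finset.sum_congr rfl fun k hk => by
        rw [wt_succ_of_le a (Nat.lt_succ_iff.1 (Finset.mem_range.1 hk)), mul_assoc],
      ← Finset.mul_sum]
    have hfin : ∑ A ∈ V, (Real.negMulLog (ν.real (D' A)) +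
          ν.real (D' A) * Real.log ((p A + ε) ^ (a i))) =
        (1 - a i) * ∑ A ∈ V, Real.negMulLog (ν.real (D' A)) +
        a i * ∑ A ∈ V, (Real.negMulLog (ν.real (D' A)) +
          ν.real (D' A) * Real.log (p A + ε)) := by
      rw [Finset.mul_sum, Finset.mul_sum, ← Finset.sum_add_distrib]
      refine Finset.sum_congr rfl fun A _ => ?_
      rw [Real.log_rpow (hpos A)]
      ring
    rw [hfin]
    linarith

theorem sum_covEnt_add_integral_le_log_wPU (hf : Continuous f) (i : ℕ)
    (hUs : ∀ k ≤ i, IsFinOpenCover (X k) (Us k)) (ha : ∀ k < i, a k ∈ Set.Icc (0 : ℝ) 1)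
    (μ : Measure (X 0).carrier) [IsProbabilityMeasure μ] :
    ∑ k ∈ Finset.range (i + 1),
        wt a (i + 1) k * covEnt (μ.map (chainMap X π k)) (coverJoin (X k) (Us k) F) +
      wt a (i + 1) 0 * ∫ x, birk (X 0) f F x ∂μ ≤
      Real.log (wPU X π a f F Us i Set.univ) := by
  set L := ∑ k ∈ Finset.range (i + 1),
        wt a (i + 1) k * covEnt (μ.map (chainMap X π k)) (coverJoin (X k) (Us k) F) +
      wt a (i + 1) 0 * ∫ x, birk (X 0) f F x ∂μ with hL
  set P := wPU X π a f F Us i Set.univ with hP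
  have hP0 : 0 ≤ P := wPU_nonneg X π i _
  have hexp : Real.exp L ≤ P := by
    refine le_of_forall_gt_imp_ge_of_dense fun c hc => ?_
    obtain ⟨O, -, hO, h⟩ := exists_open_bound X π hf i hUs ha hc
    have := h μ (by simp) (by simp [Set.univ_subset_iff.1 hO])
    rw [probReal_univ, Real.negMulLog_one, zero_add, one_mul] at this
    exact (Real.le_log_iff_exp_le (hP0.trans_lt hc)).1 this
  exact (Real.le_log_iff_exp_le ((Real.exp_pos L).trans_le hexp)).2 hexp

end FiniteEstimate

end WPP

open WPP in
/-- Claim 3.5: for any finite open covers `𝒰^{(i)}` of `X_i` and any `μ ∈ M^G(X_1)`: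
`Σ_{i=1}^r w_i h^−_{μ_i}(𝒰^{(i)},G) + w_1 ∫_{X_1} f dμ ≤ P^a(G,f,𝒰^{(1)},…,𝒰^{(r)})`. -/
theorem cover_entropy_le_cover_pressure
    {G : Type} [Group G] [Countable G] [Infinite G] [DecidableEq G]
    (Fn : ℕ → Finset G) (hFn : IsFolner G Fn)
    (X : ℕ → GSystem G) (π : ∀ i, FactorMap (X i) (X (i + 1)))
    (r : ℕ) (hr : 2 ≤ r) (a : ℕ → ℝ) (ha : ∀ i < r - 1, a i ∈ Set.Icc (0 : ℝ) 1)
    (f : (X 0).carrier → ℝ) (hf : Continuous f)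
    (Us : ∀ i, Finset (Set (X i).carrier)) (hUs : ∀ i < r, IsFinOpenCover (X i) (Us i))
    (μ : MeasureTheory.Measure (X 0).carrier) (hμ : IsInvProb (X 0) μ) :
    (((∑ i ∈ Finset.range r,
          wt a r i * hMinus (X i) Fn (μ.map (chainMap X π i)) (Us i))
        + wt a r 0 * ∫ x, f x ∂μ : ℝ) : EReal)
      ≤ pressU X π r a f Fn Us := by
  obtain ⟨i, rfl⟩ : ∃ i, r = i + 1 := ⟨r - 1, by omega⟩
  rw [Nat.add_sub_cancel] at ha
  have := hμ.1
  have hpos : ∀ n, (0 : ℝ) < (Fn n).card := fun n => by exact_mod_cast (hFn.1 n).card_pos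
  have hlim : Tendsto (fun n => ∑ k ∈ Finset.range (i + 1), wt a (i + 1) k *
        (covEnt (μ.map (chainMap X π k)) (coverJoin (X k) (Us k) (Fn n)) / ((Fn n).card : ℝ)) +
      wt a (i + 1) 0 * ∫ x, f x ∂μ) atTop
      (nhds (∑ k ∈ Finset.range (i + 1),
          wt a (i + 1) k * hMinus (X k) Fn (μ.map (chainMap X π k)) (Us k)
        + wt a (i + 1) 0 * ∫ x, f x ∂μ)) :=
    (tendsto_finsetSum _ fun k hk => (tendsto_hMinus (X k) hFn
      (hUs k (Finset.mem_range.1 hk)) (isInvProb_map_chainMap X π hμ k)).const_mul _).add_const _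
  rw [← ((continuous_coe_real_ereal.tendsto _).comp hlim).limsup_eq]
  refine limsup_le_limsup (Eventually.of_forall fun n => EReal.coe_le_coe_iff.2 ?_)
  have h := sum_covEnt_add_integral_le_log_wPU X π (F := Fn n) hf i
    (fun k hk => hUs k (Nat.lt_succ_of_le hk)) ha μ
  rw [integral_birk (X 0) hf (Fn n) hμ] at h
  rw [Nat.add_sub_cancel, le_div_iff₀ (hpos n)]
  refine le_of_eq_of_le ?_ h
  rw [add_mul, Finset.sum_mul]
  congr 1
  · refine Finset.sum_congr rfl fun k _ => ?_
    rw [mul_assoc, div_mul_cancel₀ _ (hpos n).ne']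
  · ring
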